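/- (Lemma 1) Let 0 < r < 1/2 and 0 < c < C. For every h > 0, let 0 = t₀ < t₁ < ⋯ < t_N = 1 be a partition of I = (0,1) into subintervals γᵢ = (tᵢ₋₁, tᵢ) satisfying the quasi-uniformity condition c·h ≤ |γᵢ| ≤ C·h for all i. Let v : [0,1] → ℝ be absolutely continuous with square-integrable derivative g, choose points xᵢ ∈ γᵢ, and let v_h = ∑_{i=1}^N v(xᵢ) 1_{γᵢ} be the piecewise constant interpolant. Then there exists a constant C' > 0, depending only on r, c and C, such that ‖v − v_h‖_{H^r} ≤ C' · h^{1−r} · |v|₁, where ‖w‖_{H^r} = (∫_I |w|²)^{1/2} + (∬_{I×I} |w(y) − w(x)|²/|y − x|^{1+2r} dx dy)^{1/2} and |v|₁ = (∫₀¹ g²)^{1/2}. -/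

import Mathlib

open MeasureTheory Set Finset

theorem lintegral_Ioc_rpow_neg {s L : ℝ} (hs : s < 1) (hL : 0 ≤ L) :
    ∫⁻ z in Ioc 0 L, ENNReal.ofReal (|z| ^ (-s)) = ENNReal.ofReal (L ^ (1 - s) / (1 - s)) := by
  have hint : IntervalIntegrable (fun z : ℝ => z ^ (-s)) volume 0 L :=
    intervalIntegral.intervalIntegrable_rpow' (by linarith)
  have hI : ∫ z in (0:ℝ)..L, z ^ (-s) = L ^ (1 - s) / (1 - s) := by
    rw [integral_rpow (Or.inl (by linarith)), Real.zero_rpow (by linarith)]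
    ring_nf
  rw [← hI, intervalIntegral.integral_of_le hL, ofReal_integral_eq_lintegral_ofReal]
  · refine setLIntegral_congr_fun measurableSet_Ioc fun z hz => ?_
    simp only [abs_of_pos hz.1]
  · exact (intervalIntegrable_iff_integrableOn_Ioc_of_le hL).1 hint
  · exact (ae_restrict_mem measurableSet_Ioc).mono fun z hz => Real.rpow_nonneg hz.1.le _

theorem lintegral_Ioi_rpow_neg {r d : ℝ} (hr : 0 < r) (hd : 0 < d) :
    ∫⁻ z in Ioi d, ENNReal.ofReal (|z| ^ (-(1 + 2 * r))) =
      ENNReal.ofReal (d ^ (-(2 * r)) / (2 * r)) := by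
  have hI : ∫ z in Ioi d, z ^ (-(1 + 2 * r)) = d ^ (-(2 * r)) / (2 * r) := by
    rw [integral_Ioi_rpow_of_lt (by linarith) hd]
    rw [show -(1 + 2 * r) + 1 = -(2 * r) by ring, neg_div_neg_eq]
  rw [← hI, ofReal_integral_eq_lintegral_ofReal]
  · refine setLIntegral_congr_fun measurableSet_Ioi fun z hz => ?_
    simp only [abs_of_pos (hd.trans hz)]
  · exact integrableOn_Ioi_rpow_of_lt (by linarith) hd
  · exact (ae_restrict_mem measurableSet_Ioi).mono fun z hz => Real.rpow_nonneg (hd.trans hz).le _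

theorem setLIntegral_sub_right (f : ℝ → ENNReal) {s : Set ℝ} (hs : MeasurableSet s) (x : ℝ) :
    ∫⁻ y in (fun y => y - x) ⁻¹' s, f (y - x) = ∫⁻ z in s, f z := by
  rw [← lintegral_indicator hs, ← lintegral_sub_right_eq_self (s.indicator f) x,
    ← lintegral_indicator (hs.preimage (measurable_sub_const x))]
  rfl

theorem setLIntegral_sub_left (f : ℝ → ENNReal) {s : Set ℝ} (hs : MeasurableSet s) (x : ℝ) :
    ∫⁻ y in (fun y => x - y) ⁻¹' s, f (x - y) = ∫⁻ z in s, f z := by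
  rw [← lintegral_indicator hs, ← lintegral_sub_left_eq_self (s.indicator f) x,
    ← lintegral_indicator (hs.preimage (measurable_const_sub x))]
  rfl

theorem lintegral_Ioc_rpow_sub_left {s a b : ℝ} (hs : s < 1) (hab : a ≤ b) :
    ∫⁻ y in Ioc a b, ENNReal.ofReal (|y - a| ^ (-s)) =
      ENNReal.ofReal ((b - a) ^ (1 - s) / (1 - s)) := by
  rw [← lintegral_Ioc_rpow_neg hs (sub_nonneg.2 hab),
    ← setLIntegral_sub_right _ (s := Ioc 0 (b - a)) measurableSet_Ioc a]
  simp

theorem lintegral_Ioc_rpow_sub_right {s a b : ℝ} (hs : s < 1) (hab : a ≤ b) :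
    ∫⁻ y in Ioc a b, ENNReal.ofReal (|y - b| ^ (-s)) =
      ENNReal.ofReal ((b - a) ^ (1 - s) / (1 - s)) := by
  rw [← lintegral_Ioc_rpow_neg hs (sub_nonneg.2 hab),
    ← setLIntegral_sub_left _ (s := Ioc 0 (b - a)) measurableSet_Ioc b, setLIntegral_congr Ico_ae_eq_Ioc.symm]
  simp [abs_sub_comm]

theorem lintegral_lintegral_Ioc_rpow_le {r a b M : ℝ} (hr : r < 1 / 2) (hab : a ≤ b)
    (hM : b - a ≤ M) :
    ∫⁻ x in Ioc a b, ∫⁻ y in Ioc a b, ENNReal.ofReal (|y - x| ^ (-(2 * r))) ≤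
      ENNReal.ofReal (2 * (M * (M ^ (1 - 2 * r) / (1 - 2 * r)))) := by
  have hM0 : 0 ≤ M := by linarith
  have h1 : 0 < 1 - 2 * r := by linarith
  set D := M ^ (1 - 2 * r) / (1 - 2 * r) with hD
  have hD0 : 0 ≤ D := by positivity
  have hin : ∀ x ∈ Ioc a b, ∫⁻ y in Ioc a b, ENNReal.ofReal (|y - x| ^ (-(2 * r))) ≤
      ENNReal.ofReal (2 * D) := by
    intro x hx
    rw [← Ioc_union_Ioc_eq_Ioc hx.1.le hx.2, two_mul D, ENNReal.ofReal_add hD0 hD0]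
    refine (lintegral_union_le _ _ _).trans (add_le_add ?_ ?_)
    · rw [lintegral_Ioc_rpow_sub_right (by linarith) hx.1.le, hD]
      have := hx.2
      have := hx.1
      gcongr; linarith
    · rw [lintegral_Ioc_rpow_sub_left (by linarith) hx.2, hD]
      have := hx.2
      have := hx.1
      gcongr; linarith
  calc _ ≤ ∫⁻ x in Ioc a b, ENNReal.ofReal (2 * D) := setLIntegral_mono' measurableSet_Ioc hin
    _ = ENNReal.ofReal (2 * D * (b - a)) := by
      rw [setLIntegral_const, Real.volume_Ioc, ENNReal.ofReal_mul (p := 2 * D) (by positivity)]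
    _ ≤ _ := ENNReal.ofReal_le_ofReal (by nlinarith)

theorem lintegral_compl_Ioc_rpow_le {r a b x : ℝ} (hr : 0 < r) (hx : x ∈ Ioo a b) :
    ∫⁻ y in (Ioc a b)ᶜ, ENNReal.ofReal (|y - x| ^ (-(1 + 2 * r))) ≤
      ENNReal.ofReal (1 / (2 * r)) * (ENNReal.ofReal (|x - a| ^ (-(2 * r))) +
        ENNReal.ofReal (|x - b| ^ (-(2 * r)))) := by
  have h1 : 0 < x - a := sub_pos.2 hx.1
  have h2 : 0 < b - x := sub_pos.2 hx.2
  have hl : ∫⁻ y in Iic a, ENNReal.ofReal (|y - x| ^ (-(1 + 2 * r))) =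
      ENNReal.ofReal ((x - a) ^ (-(2 * r)) / (2 * r)) := by
    rw [← lintegral_Ioi_rpow_neg hr h1, ← setLIntegral_sub_left _ (s := Ioi (x - a)) measurableSet_Ioi x,
      setLIntegral_congr Iio_ae_eq_Iic.symm]
    simp [abs_sub_comm]
  have hu : ∫⁻ y in Ioi b, ENNReal.ofReal (|y - x| ^ (-(1 + 2 * r))) =
      ENNReal.ofReal ((b - x) ^ (-(2 * r)) / (2 * r)) := by
    rw [← lintegral_Ioi_rpow_neg hr h2, ← setLIntegral_sub_right _ (s := Ioi (b - x)) measurableSet_Ioi x]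
    simp
  rw [compl_Ioc]
  refine (lintegral_union_le _ _ _).trans ?_
  rw [hl, hu, abs_of_pos h1, abs_sub_comm x b, abs_of_pos h2, mul_add,
    ← ENNReal.ofReal_mul (by positivity), ← ENNReal.ofReal_mul (by positivity)]
  apply le_of_eq
  congr 2 <;> ring

theorem lintegral_Ioc_lintegral_compl_rpow_le {r a b M : ℝ} (hr0 : 0 < r) (hr : r < 1 / 2)
    (hab : a ≤ b) (hM : b - a ≤ M) :
    ∫⁻ x in Ioc a b, ∫⁻ y in (Ioc a b)ᶜ, ENNReal.ofReal (|y - x| ^ (-(1 + 2 * r))) ≤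
      ENNReal.ofReal (M ^ (1 - 2 * r) / (1 - 2 * r) / r) := by
  have h1 : 0 < 1 - 2 * r := by linarith
  have hba : 0 ≤ b - a := by linarith
  calc _ = ∫⁻ x in Ioo a b, ∫⁻ y in (Ioc a b)ᶜ, ENNReal.ofReal (|y - x| ^ (-(1 + 2 * r))) :=
        setLIntegral_congr Ioo_ae_eq_Ioc.symm
    _ ≤ ∫⁻ x in Ioo a b, ENNReal.ofReal (1 / (2 * r)) * (ENNReal.ofReal (|x - a| ^ (-(2 * r))) +
        ENNReal.ofReal (|x - b| ^ (-(2 * r)))) :=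
        setLIntegral_mono' measurableSet_Ioo fun x hx => lintegral_compl_Ioc_rpow_le hr0 hx
    _ = ENNReal.ofReal ((b - a) ^ (1 - 2 * r) / (1 - 2 * r) / r) := by
        rw [setLIntegral_congr Ioo_ae_eq_Ioc, lintegral_const_mul _ (by fun_prop),
          lintegral_add_left (by fun_prop), lintegral_Ioc_rpow_sub_left (by linarith) hab,
          lintegral_Ioc_rpow_sub_right (by linarith) hab,
          ← ENNReal.ofReal_add (by positivity) (by positivity),
          ← ENNReal.ofReal_mul (by positivity)]
        congr 1
        field_simp
        ring
    _ ≤ _ := by gcongr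

theorem sq_integral_le {g : ℝ → ℝ} {p q : ℝ} (hpq : p ≤ q)
    (hg : IntervalIntegrable g volume p q)
    (hg2 : IntervalIntegrable (fun s => g s ^ 2) volume p q) :
    (∫ s in p..q, g s) ^ 2 ≤ (q - p) * ∫ s in p..q, g s ^ 2 := by
  rcases hpq.eq_or_lt with rfl | hlt
  · simp
  set m := (∫ s in p..q, g s) / (q - p) with hm
  have hL : 0 < q - p := sub_pos.2 hlt
  have h0 : 0 ≤ ∫ s in p..q, (g s ^ 2 - 2 * m * g s + m ^ 2) :=
    intervalIntegral.integral_nonneg hpq fun s _ => by nlinarith [sq_nonneg (g s - m)]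
  rw [intervalIntegral.integral_add (hg2.sub (hg.const_mul _)) (by simp),
    intervalIntegral.integral_sub hg2 (hg.const_mul _), intervalIntegral.integral_const_mul,
    intervalIntegral.integral_const, smul_eq_mul] at h0
  have hI : ∫ s in p..q, g s = m * (q - p) := by rw [hm]; field_simp
  rw [hI] at h0 ⊢
  nlinarith

theorem sq_sub_le_of_integral {v g : ℝ → ℝ} {a b : ℝ}
    (hg : IntegrableOn g (Icc a b)) (hg2 : IntegrableOn (fun s => g s ^ 2) (Icc a b))
    (hv : ∀ p ∈ Icc a b, ∀ q ∈ Icc a b, v q - v p = ∫ s in p..q, g s)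
    {p q : ℝ} (hp : p ∈ Icc a b) (hq : q ∈ Icc a b) :
    (v q - v p) ^ 2 ≤ |q - p| * ∫ s in a..b, g s ^ 2 := by
  wlog hpq : p ≤ q generalizing p q
  · have := this hq hp (le_of_not_ge hpq)
    rwa [abs_sub_comm, ← neg_sub, neg_sq] at this
  have hsub : Ioc p q ⊆ Icc a b := fun s hs => ⟨hp.1.trans hs.1.le, hs.2.trans hq.2⟩
  have hab : a ≤ b := hp.1.trans hp.2
  rw [hv p hp q hq, abs_of_nonneg (sub_nonneg.2 hpq)]
  refine (sq_integral_le hpq ?_ ?_).trans (mul_le_mul_of_nonneg_left ?_ (sub_nonneg.2 hpq))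
  · exact (intervalIntegrable_iff_integrableOn_Ioc_of_le hpq).2 (hg.mono_set hsub)
  · exact (intervalIntegrable_iff_integrableOn_Ioc_of_le hpq).2 (hg2.mono_set hsub)
  · refine intervalIntegral.integral_mono_interval hp.1 hpq hq.2
      (Filter.Eventually.of_forall fun s => sq_nonneg _) ?_
    exact (intervalIntegrable_iff_integrableOn_Icc_of_le hab).2 hg2

theorem abs_sq_div_rpow_le {u d G r : ℝ} (hG0 : 0 ≤ G) (hG : u ^ 2 ≤ |d| * G) :
    |u| ^ 2 / |d| ^ (1 + 2 * r) ≤ G * |d| ^ (-(2 * r)) := by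
  rcases eq_or_ne d 0 with rfl | hd
  · have : u = 0 := by simpa using hG
    simpa [this] using mul_nonneg hG0 (Real.rpow_nonneg le_rfl _)
  have hd : 0 < |d| := abs_pos.2 hd
  rw [sq_abs, Real.rpow_neg hd.le, Real.rpow_add hd, Real.rpow_one, ← div_eq_mul_inv,
    ← div_div]
  gcongr
  rw [div_le_iff₀ hd]
  linarith

theorem exists_mem_Ioc_of_partition {t : ℕ → ℝ} {x : ℝ} :
    ∀ {N : ℕ}, x ∈ Ioc (t 0) (t N) → ∃ i < N, x ∈ Ioc (t i) (t (i + 1))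
  | 0, hx => absurd hx.1 hx.2.not_gt
  | N + 1, hx => by
    rcases le_or_gt x (t N) with h | h
    · obtain ⟨i, hi, hxi⟩ := exists_mem_Ioc_of_partition ⟨hx.1, h⟩
      exact ⟨i, by omega, hxi⟩
    · exact ⟨N, by omega, h, hx.2⟩

theorem partition_monotoneOn {t : ℕ → ℝ} {N : ℕ} (ht : ∀ i < N, t i < t (i + 1)) :
    ∀ {i j : ℕ}, i ≤ j → j ≤ N → t i ≤ t j := by
  intro i j hij
  induction hij with
  | refl => simp
  | step _ ih => exact fun hj => (ih (by omega)).trans (ht _ (by omega)).le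

theorem sum_indicator_partition {t : ℕ → ℝ} {N : ℕ} (ht : ∀ i < N, t i < t (i + 1))
    (u : ℕ → ℝ) {i : ℕ} (hi : i < N) {x : ℝ} (hx : x ∈ Ioc (t i) (t (i + 1))) :
    ∑ j ∈ Finset.range N, Set.indicator (Ioc (t j) (t (j + 1))) (fun _ => u j) x = u i := by
  rw [Finset.sum_eq_single_of_mem i (Finset.mem_range.2 hi), Set.indicator_of_mem hx]
  intro j hj hji
  refine Set.indicator_of_notMem (fun hxj => ?_) _
  rw [Finset.mem_range] at hj
  rcases lt_or_gt_of_ne hji with h | h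
  · exact (hxj.2.trans (partition_monotoneOn ht (Nat.succ_le_of_lt h) hi.le)).not_gt hx.1
  · exact (hx.2.trans (partition_monotoneOn ht (Nat.succ_le_of_lt h) hj.le)).not_gt hxj.1

theorem sum_integral_partition {t : ℕ → ℝ} {N : ℕ} (ht : ∀ i < N, t i < t (i + 1))
    {f : ℝ → ℝ} (hf : IntegrableOn f (Icc (t 0) (t N))) :
    ∑ i ∈ Finset.range N, ∫ s in t i..t (i + 1), f s = ∫ s in t 0..t N, f s := by
  refine intervalIntegral.sum_integral_adjacent_intervals fun i hi => ?_
  refine (intervalIntegrable_iff_integrableOn_Icc_of_le (ht i hi).le).2 (hf.mono_set ?_)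
  exact Icc_subset_Icc (partition_monotoneOn ht (Nat.zero_le i) hi.le)
    (partition_monotoneOn ht hi le_rfl)

theorem integral_le_of_enorm_lintegral_le {a b K : ℝ} (hab : a ≤ b) (hK : 0 ≤ K) {f : ℝ → ℝ}
    (hf : ∫⁻ x in Ioc a b, ‖f x‖ₑ ≤ ENNReal.ofReal K) : ∫ x in a..b, f x ≤ K := by
  rw [intervalIntegral.integral_of_le hab]
  have h := (enorm_integral_le_lintegral_enorm (μ := volume.restrict (Ioc a b)) f).trans hf
  rw [← ofReal_norm, ENNReal.ofReal_le_ofReal_iff hK] at h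
  exact (le_abs_self _).trans h

theorem enorm_le_ofReal_of_le {z K : ℝ} (hz : 0 ≤ z) (h : z ≤ K) : ‖z‖ₑ ≤ ENNReal.ofReal K := by
  rw [Real.enorm_eq_ofReal hz]
  exact ENNReal.ofReal_le_ofReal h

/-- An `L²` bound on a union of consecutive cells from a sup bound on each cell; no measurability
of `w` is needed. -/
theorem integral_sq_le_of_partition {t : ℕ → ℝ} {N : ℕ} (ht : ∀ i < N, t i < t (i + 1))
    {M : ℝ} (hM0 : 0 ≤ M) (hM : ∀ i < N, t (i + 1) - t i ≤ M) {G : ℕ → ℝ} (hG : ∀ i, 0 ≤ G i)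
    {w : ℝ → ℝ} (hw : ∀ i < N, ∀ x ∈ Ioc (t i) (t (i + 1)), w x ^ 2 ≤ M * G i) :
    ∫ x in t 0..t N, |w x| ^ 2 ≤ M ^ 2 * ∑ i ∈ Finset.range N, G i := by
  have hS : 0 ≤ ∑ i ∈ Finset.range N, G i := Finset.sum_nonneg fun i _ => hG i
  refine integral_le_of_enorm_lintegral_le (partition_monotoneOn ht (Nat.zero_le N) le_rfl)
    (by positivity) ?_
  calc ∫⁻ x in Ioc (t 0) (t N), ‖|w x| ^ 2‖ₑ
      ≤ ∫⁻ x in Ioc (t 0) (t N), ∑ i ∈ Finset.range N,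
          (Ioc (t i) (t (i + 1))).indicator (fun _ => ENNReal.ofReal (M * G i)) x := by
        refine setLIntegral_mono' measurableSet_Ioc fun x hx => ?_
        obtain ⟨i, hi, hxi⟩ := exists_mem_Ioc_of_partition hx
        refine le_trans ?_ (Finset.single_le_sum (fun _ _ => zero_le) (Finset.mem_range.2 hi))
        rw [Set.indicator_of_mem hxi]
        exact enorm_le_ofReal_of_le (by positivity) (by rw [sq_abs]; exact hw i hi x hxi)
    _ ≤ ∫⁻ x, ∑ i ∈ Finset.range N,
          (Ioc (t i) (t (i + 1))).indicator (fun _ => ENNReal.ofReal (M * G i)) x :=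
        setLIntegral_le_lintegral _ _
    _ = ∑ i ∈ Finset.range N, ENNReal.ofReal (M * G i) * ENNReal.ofReal (t (i + 1) - t i) := by
        rw [lintegral_finsetSum _ fun i _ => measurable_const.indicator measurableSet_Ioc]
        refine Finset.sum_congr rfl fun i _ => ?_
        rw [lintegral_indicator measurableSet_Ioc, setLIntegral_const, Real.volume_Ioc]
    _ ≤ ∑ i ∈ Finset.range N, ENNReal.ofReal (M ^ 2 * G i) := by
        refine Finset.sum_le_sum fun i hi => ?_
        have hGi := hG i
        rw [← ENNReal.ofReal_mul (by positivity)]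
        apply ENNReal.ofReal_le_ofReal
        have := mul_le_mul_of_nonneg_left (hM i (Finset.mem_range.1 hi)) (mul_nonneg hM0 hGi)
        linarith
    _ = _ := by
        rw [Finset.mul_sum, ENNReal.ofReal_sum_of_nonneg]
        exact fun i _ => mul_nonneg (sq_nonneg _) (hG i)

/-- A Slobodeckij seminorm bound on a union of consecutive cells, for a function that may jump
between cells, from a sup bound and a Hölder-`1/2` bound on each cell. -/
theorem integral_slobodeckij_le_of_partition {r : ℝ} (hr0 : 0 < r) (hr : r < 1 / 2)
    {t : ℕ → ℝ} {N : ℕ} (ht : ∀ i < N, t i < t (i + 1))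
    {M : ℝ} (hM0 : 0 < M) (hM : ∀ i < N, t (i + 1) - t i ≤ M) {G : ℕ → ℝ} (hG : ∀ i, 0 ≤ G i)
    {w : ℝ → ℝ} (hw : ∀ i < N, ∀ x ∈ Ioc (t i) (t (i + 1)), w x ^ 2 ≤ M * G i)
    (hw' : ∀ i < N, ∀ x ∈ Ioc (t i) (t (i + 1)), ∀ y ∈ Ioc (t i) (t (i + 1)),
      (w y - w x) ^ 2 ≤ |y - x| * G i) :
    ∫ x in t 0..t N, ∫ y in t 0..t N, |w y - w x| ^ 2 / |y - x| ^ (1 + 2 * r) ≤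
      (2 + 4 / r) / (1 - 2 * r) * (M * M ^ (1 - 2 * r)) * ∑ i ∈ Finset.range N, G i := by
  have h1 : 0 < 1 - 2 * r := by linarith
  have hS : 0 ≤ ∑ i ∈ Finset.range N, G i := Finset.sum_nonneg fun i _ => hG i
  have h0N := partition_monotoneOn ht (Nat.zero_le N) le_rfl
  set γ : ℕ → Set ℝ := fun i => Ioc (t i) (t (i + 1)) with hγ
  have hγm : ∀ i, MeasurableSet (γ i) := fun i => measurableSet_Ioc
  set P : ℝ × ℝ → ENNReal := fun z => ENNReal.ofReal (|z.2 - z.1| ^ (-(2 * r))) with hP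
  set Q : ℝ × ℝ → ENNReal := fun z => ENNReal.ofReal (|z.2 - z.1| ^ (-(1 + 2 * r))) with hQ
  have hPm : Measurable P := by fun_prop
  have hQm : Measurable Q := by fun_prop
  set K : ℕ → ℝ × ℝ → ENNReal := fun i z =>
    ENNReal.ofReal (G i) * (γ i ×ˢ γ i).indicator P z +
      ENNReal.ofReal (2 * (M * G i)) *
        ((γ i ×ˢ (γ i)ᶜ).indicator Q z + ((γ i)ᶜ ×ˢ γ i).indicator Q z) with hK
  have hpt : ∀ x ∈ Ioc (t 0) (t N), ∀ y ∈ Ioc (t 0) (t N),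
      ‖|w y - w x| ^ 2 / |y - x| ^ (1 + 2 * r)‖ₑ ≤ ∑ i ∈ Finset.range N, K i (x, y) := by
    intro x hx y hy
    have hnn : 0 ≤ |w y - w x| ^ 2 / |y - x| ^ (1 + 2 * r) := by positivity
    obtain ⟨i, hi, hxi⟩ := exists_mem_Ioc_of_partition hx
    obtain ⟨j, hj, hyj⟩ := exists_mem_Ioc_of_partition hy
    by_cases hyi : y ∈ γ i
    · refine le_trans ?_ (Finset.single_le_sum (fun _ _ => zero_le) (Finset.mem_range.2 hi))
      refine le_trans ?_ le_self_add
      rw [Set.indicator_of_mem (show (x, y) ∈ γ i ×ˢ γ i from ⟨hxi, hyi⟩),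
        ← ENNReal.ofReal_mul (hG i)]
      exact enorm_le_ofReal_of_le hnn (abs_sq_div_rpow_le (hG i) (hw' i hi x hxi y hyi))
    by_cases hxj : x ∈ γ j
    · refine le_trans ?_ (Finset.single_le_sum (fun _ _ => zero_le) (Finset.mem_range.2 hj))
      refine le_trans ?_ le_self_add
      rw [Set.indicator_of_mem (show (x, y) ∈ γ j ×ˢ γ j from ⟨hxj, hyj⟩),
        ← ENNReal.ofReal_mul (hG j)]
      exact enorm_le_ofReal_of_le hnn (abs_sq_div_rpow_le (hG j) (hw' j hj x hxj y hyj))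
    have hij : i ≠ j := fun h => hyi (h ▸ hyj)
    have hsub : {i, j} ⊆ Finset.range N := by
      intro k hk
      rcases Finset.mem_insert.1 hk with rfl | hk
      · exact Finset.mem_range.2 hi
      · rw [Finset.mem_singleton.1 hk]
        exact Finset.mem_range.2 hj
    refine le_trans ?_ (Finset.sum_le_sum_of_subset hsub)
    rw [Finset.sum_pair hij]
    have hGi := hG i
    have hGj := hG j
    calc _ ≤ ENNReal.ofReal (2 * (M * G i) * |y - x| ^ (-(1 + 2 * r)) +
          2 * (M * G j) * |y - x| ^ (-(1 + 2 * r))) := by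
          refine enorm_le_ofReal_of_le hnn ?_
          rw [div_eq_mul_inv, ← Real.rpow_neg (abs_nonneg _), ← add_mul, sq_abs]
          gcongr
          nlinarith [hw i hi x hxi, hw j hj y hyj, sq_nonneg (w y + w x)]
      _ = ENNReal.ofReal (2 * (M * G i)) * (γ i ×ˢ (γ i)ᶜ).indicator Q (x, y) +
          ENNReal.ofReal (2 * (M * G j)) * ((γ j)ᶜ ×ˢ γ j).indicator Q (x, y) := by
          rw [Set.indicator_of_mem (show (x, y) ∈ γ i ×ˢ (γ i)ᶜ from ⟨hxi, hyi⟩),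
            Set.indicator_of_mem (show (x, y) ∈ (γ j)ᶜ ×ˢ γ j from ⟨hxj, hyj⟩),
            ENNReal.ofReal_add (by positivity) (by positivity),
            ENNReal.ofReal_mul (p := 2 * (M * G i)) (by positivity),
            ENNReal.ofReal_mul (p := 2 * (M * G j)) (by positivity)]
      _ ≤ _ := by
          refine add_le_add ?_ ?_
          · exact le_trans (by gcongr; exact le_self_add) le_add_self
          · exact le_trans (by gcongr; exact le_add_self) le_add_self
  have hprod : ∀ (s u : Set ℝ) (f : ℝ × ℝ → ENNReal), MeasurableSet s → MeasurableSet u →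
      Measurable f → ∫⁻ z, (s ×ˢ u).indicator f z ∂(volume.prod volume) =
        ∫⁻ x in s, ∫⁻ y in u, f (x, y) := by
    intro s u f hs hu hf
    rw [lintegral_indicator (hs.prod hu), ← Measure.prod_restrict,
      lintegral_prod _ hf.aemeasurable]
  have hKm : ∀ i, Measurable (K i) := fun i => by
    have h₁ := hPm.indicator ((hγm i).prod (hγm i))
    have h₂ := hQm.indicator ((hγm i).prod (hγm i).compl)
    have h₃ := hQm.indicator ((hγm i).compl.prod (hγm i))
    exact (h₁.const_mul _).add ((h₂.add h₃).const_mul _)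
  have hKi : ∀ i < N, ∫⁻ z, K i z ∂(volume.prod volume) ≤
      ENNReal.ofReal ((2 + 4 / r) / (1 - 2 * r) * (M * M ^ (1 - 2 * r)) * G i) := by
    intro i hi
    have hGi := hG i
    have h₁ := hPm.indicator ((hγm i).prod (hγm i))
    have h₂ := hQm.indicator ((hγm i).prod (hγm i).compl)
    have h₃ := hQm.indicator ((hγm i).compl.prod (hγm i))
    have hb := lintegral_Ioc_lintegral_compl_rpow_le hr0 hr (ht i hi).le (hM i hi)
    have e₃ : ∫⁻ x in (γ i)ᶜ, ∫⁻ y in γ i, Q (x, y) = ∫⁻ x in γ i, ∫⁻ y in (γ i)ᶜ, Q (x, y) := by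
      rw [lintegral_lintegral_swap (f := fun x y => Q (x, y)) hQm.aemeasurable]
      simp only [hQ, abs_sub_comm]
    rw [lintegral_add_left (h₁.const_mul _), lintegral_const_mul _ h₁,
      lintegral_const_mul _ (h₂.fun_add h₃), lintegral_add_left h₂,
      hprod _ _ _ (hγm i) (hγm i) hPm, hprod _ _ _ (hγm i) (hγm i).compl hQm,
      hprod _ _ _ (hγm i).compl (hγm i) hQm, e₃]
    calc _ ≤ ENNReal.ofReal (G i) *
            ENNReal.ofReal (2 * (M * (M ^ (1 - 2 * r) / (1 - 2 * r)))) +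
          ENNReal.ofReal (2 * (M * G i)) *
            (ENNReal.ofReal (M ^ (1 - 2 * r) / (1 - 2 * r) / r) +
              ENNReal.ofReal (M ^ (1 - 2 * r) / (1 - 2 * r) / r)) := by
          refine add_le_add (mul_le_mul_right ?_ _) (mul_le_mul_right (add_le_add hb hb) _)
          exact lintegral_lintegral_Ioc_rpow_le hr (ht i hi).le (hM i hi)
      _ = _ := by
          rw [← ENNReal.ofReal_add (by positivity) (by positivity),
            ← ENNReal.ofReal_mul (by positivity), ← ENNReal.ofReal_mul (by positivity),
            ← ENNReal.ofReal_add (by positivity) (by positivity)]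
          congr 1
          field_simp
          ring
  refine integral_le_of_enorm_lintegral_le h0N (by positivity) ?_
  calc _ ≤ ∫⁻ x in Ioc (t 0) (t N), ∫⁻ y in Ioc (t 0) (t N), ∑ i ∈ Finset.range N, K i (x, y) := by
        refine setLIntegral_mono' measurableSet_Ioc fun x hx => ?_
        rw [intervalIntegral.integral_of_le h0N]
        exact (enorm_integral_le_lintegral_enorm _).trans
          (setLIntegral_mono' measurableSet_Ioc fun y hy => hpt x hx y hy)
    _ ≤ ∫⁻ x, ∫⁻ y, ∑ i ∈ Finset.range N, K i (x, y) :=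
        (setLIntegral_le_lintegral _ _).trans
          (lintegral_mono fun x => setLIntegral_le_lintegral _ _)
    _ = ∑ i ∈ Finset.range N, ∫⁻ z, K i z ∂(volume.prod volume) := by
        rw [← lintegral_finsetSum _ fun i _ => hKm i, lintegral_prod]
        exact (Finset.measurable_fun_sum _ fun i _ => hKm i).aemeasurable
    _ ≤ _ := by
        rw [Finset.mul_sum, ENNReal.ofReal_sum_of_nonneg]
        · exact Finset.sum_le_sum fun i hi => hKi i (Finset.mem_range.1 hi)
        · intro i _
          have := hG i
          positivity

/-- Lemma 1: for `0 < r < 1/2` and quasi-uniformity constants `0 < c < C`,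
there is a constant `C' > 0` (depending only on `r`, `c`, `C`) such that for
every partition of `(0,1)` into subintervals `γᵢ` with `c·h ≤ |γᵢ| ≤ C·h`,
every absolutely continuous `v` with square-integrable derivative `g`, and the
piecewise constant interpolant `v_h = ∑ᵢ v(xᵢ) 1_{γᵢ}`, one has
`‖v - v_h‖_{H^r} ≤ C' h^(1-r) |v|₁`, where
`‖w‖_{H^r} = (∫_I w²)^(1/2) + (∬_{I×I} |w(y)-w(x)|²/|y-x|^(1+2r))^(1/2)` and
`|v|₁ = (∫₀¹ g²)^(1/2)`. -/
theorem lemma1_interpolation (r c C : ℝ) (hr0 : 0 < r) (hr : r < 1 / 2)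
    (hc : 0 < c) (hcC : c < C) :
    ∃ C' > (0:ℝ), ∀ (h : ℝ), 0 < h →
    ∀ (N : ℕ) (t : ℕ → ℝ), t 0 = 0 → t N = 1 →
    (∀ i < N, t i < t (i + 1)) →
    (∀ i < N, c * h ≤ t (i + 1) - t i ∧ t (i + 1) - t i ≤ C * h) →
    ∀ (v g : ℝ → ℝ),
    IntegrableOn g (Icc (0:ℝ) 1) →
    IntegrableOn (fun s => g s ^ 2) (Icc (0:ℝ) 1) →
    (∀ p ∈ Icc (0:ℝ) 1, ∀ q ∈ Icc (0:ℝ) 1, v q - v p = ∫ s in p..q, g s) →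
    ∀ (xp : ℕ → ℝ), (∀ i < N, xp i ∈ Ioc (t i) (t (i + 1))) →
    ∀ (w : ℝ → ℝ),
    (∀ y, w y = v y -
      ∑ i ∈ Finset.range N, Set.indicator (Ioc (t i) (t (i + 1))) (fun _ => v (xp i)) y) →
    Real.sqrt (∫ x in (0:ℝ)..1, |w x| ^ 2) +
      Real.sqrt (∫ x in (0:ℝ)..1, ∫ y in (0:ℝ)..1, |w y - w x| ^ 2 / |y - x| ^ (1 + 2 * r)) ≤
      C' * h ^ (1 - r) * Real.sqrt (∫ s in (0:ℝ)..1, g s ^ 2) := by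
  have h1 : 0 < 1 - 2 * r := by linarith
  have hC : 0 < C := hc.trans hcC
  set D := (2 + 4 / r) / (1 - 2 * r) with hD
  have hD0 : 0 < D := by positivity
  refine ⟨C * (1 / c) ^ r + C ^ (1 - r) * √D, by positivity, ?_⟩
  intro h hh N t ht0 htN ht hcell v g hg hg2 hv xp hxp w hw
  have hN : 0 < N := by
    rcases Nat.eq_zero_or_pos N with rfl | hN
    · rw [ht0] at htN
      exact absurd htN zero_ne_one
    · exact hN
  have hsub : ∀ i < N, Icc (t i) (t (i + 1)) ⊆ Icc (0:ℝ) 1 := fun i hi => by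
    rw [← ht0, ← htN]
    exact Icc_subset_Icc (partition_monotoneOn ht (Nat.zero_le i) hi.le)
      (partition_monotoneOn ht hi le_rfl)
  set G : ℕ → ℝ := fun i => |∫ s in t i..t (i + 1), g s ^ 2| with hGdef
  have hG : ∀ i, 0 ≤ G i := fun i => abs_nonneg _
  have hGsum : ∑ i ∈ Finset.range N, G i = ∫ s in (0:ℝ)..1, g s ^ 2 := by
    have hs := sum_integral_partition (f := fun s => g s ^ 2) ht (by rwa [ht0, htN])
    rw [ht0, htN] at hs
    rw [← hs]
    exact Finset.sum_congr rfl fun i hi => abs_of_nonneg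
      (intervalIntegral.integral_nonneg (ht i (Finset.mem_range.1 hi)).le fun s _ => sq_nonneg _)
  have hvG : ∀ i < N, ∀ x ∈ Ioc (t i) (t (i + 1)), ∀ y ∈ Ioc (t i) (t (i + 1)),
      (v y - v x) ^ 2 ≤ |y - x| * G i := fun i hi x hx y hy =>
    (sq_sub_le_of_integral (hg.mono_set (hsub i hi)) (hg2.mono_set (hsub i hi))
      (fun p hp q hq => hv p (hsub i hi hp) q (hsub i hi hq)) (Ioc_subset_Icc_self hx)
      (Ioc_subset_Icc_self hy)).trans (mul_le_mul_of_nonneg_left (le_abs_self _) (abs_nonneg _))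
  have hwv : ∀ i < N, ∀ x ∈ Ioc (t i) (t (i + 1)), w x = v x - v (xp i) := fun i hi x hx => by
    rw [hw, sum_indicator_partition ht (fun i => v (xp i)) hi hx]
  have hM : ∀ i < N, t (i + 1) - t i ≤ C * h := fun i hi => (hcell i hi).2
  have hw1 : ∀ i < N, ∀ x ∈ Ioc (t i) (t (i + 1)), w x ^ 2 ≤ C * h * G i := fun i hi x hx => by
    rw [hwv i hi x hx]
    refine (hvG i hi _ (hxp i hi) x hx).trans (mul_le_mul_of_nonneg_right ?_ (hG i))
    refine le_trans ?_ (hM i hi)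
    have hx' := hxp i hi
    rw [abs_le]
    constructor <;> linarith [hx.1, hx.2, hx'.1, hx'.2]
  have hw2 : ∀ i < N, ∀ x ∈ Ioc (t i) (t (i + 1)), ∀ y ∈ Ioc (t i) (t (i + 1)),
      (w y - w x) ^ 2 ≤ |y - x| * G i := fun i hi x hx y hy => by
    rw [hwv i hi x hx, hwv i hi y hy, sub_sub_sub_cancel_right]
    exact hvG i hi x hx y hy
  have hM0 : 0 < C * h := mul_pos hC hh
  have hL2 := integral_sq_le_of_partition ht hM0.le hM hG hw1
  have hHr := integral_slobodeckij_le_of_partition hr0 hr ht hM0 hM hG hw1 hw2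
  rw [ht0, htN, hGsum] at hL2 hHr
  set E := ∫ s in (0:ℝ)..1, g s ^ 2 with hE
  have hch : h ≤ 1 / c := by
    rw [le_div_iff₀ hc]
    have h₁ := (hcell 0 hN).1
    have h₂ := partition_monotoneOn ht hN le_rfl
    simp only [Nat.succ_eq_add_one, zero_add] at h₁ h₂
    linarith
  have hpow : h ≤ (1 / c) ^ r * h ^ (1 - r) := by
    calc h = h ^ r * h ^ (1 - r) := by
          rw [← Real.rpow_add hh, add_sub_cancel, Real.rpow_one]
      _ ≤ _ := by gcongr
  have hsq : C * h * (C * h) ^ (1 - 2 * r) = (C ^ (1 - r) * h ^ (1 - r)) ^ 2 := by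
    rw [← Real.mul_rpow hC.le hh.le, ← Real.rpow_natCast, ← Real.rpow_mul hM0.le,
      ← Real.rpow_one_add' hM0.le (by linarith)]
    congr 1
    push_cast
    ring
  have hA : √(∫ x in (0:ℝ)..1, |w x| ^ 2) ≤ C * (1 / c) ^ r * h ^ (1 - r) * √E := by
    refine (Real.sqrt_le_sqrt hL2).trans ?_
    rw [Real.sqrt_mul (sq_nonneg _), Real.sqrt_sq hM0.le, mul_assoc C ((1 / c) ^ r)]
    gcongr
  have hB : √(∫ x in (0:ℝ)..1, ∫ y in (0:ℝ)..1, |w y - w x| ^ 2 / |y - x| ^ (1 + 2 * r)) ≤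
      C ^ (1 - r) * √D * h ^ (1 - r) * √E := by
    refine (Real.sqrt_le_sqrt hHr).trans (le_of_eq ?_)
    rw [hsq, Real.sqrt_mul (by positivity), Real.sqrt_mul hD0.le, Real.sqrt_sq (by positivity)]
    ring
  linarith
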